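/- arXiv:2412.10379 — 14 statements merged into one kernel-verified Lean document; each statement's English description precedes it below -/
import Mathlib

section
/- Let (M, μ) be a topological Mal'tsev algebra and let ~ be a congruence on (M, μ). Then for every open subset U of M, the ~-saturation of U, i.e. the set {x ∈ M : there exists u ∈ U with x ~ u}, is open in M. -/
/-- Theorem B for Mal'tsev algebras: the saturation of an open set with respect to a
congruence on a topological Mal'tsev algebra is open. -/
theorem maltsev_saturation_isOpen {M : Type*} [TopologicalSpace M]
    (μ : M → M → M → M)
    (hμc : Continuous fun p : M × M × M => μ p.1 p.2.1 p.2.2)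
    (hμ1 : ∀ x y : M, μ x y y = x) (hμ2 : ∀ x y : M, μ y y x = x)
    (s : Setoid M)
    (hcong : ∀ x₁ y₁ x₂ y₂ x₃ y₃ : M, s.r x₁ y₁ → s.r x₂ y₂ → s.r x₃ y₃ →
      s.r (μ x₁ x₂ x₃) (μ y₁ y₂ y₃))
    (U : Set M) (hU : IsOpen U) :
    IsOpen {x : M | ∃ u ∈ U, s.r x u} := by
  rw [isOpen_iff_mem_nhds]
  rintro x ⟨u, hu, hxu⟩
  have hc : Continuous fun z : M => μ z x u :=
    hμc.comp (continuous_id.prodMk (continuous_const (y := (x, u))))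
  have hxU : μ x x u ∈ U := by rwa [hμ2]
  filter_upwards [(hU.preimage hc).mem_nhds hxU] with z hz
  have hrel := hcong z z x x x u (s.refl z) (s.refl x) hxu
  rw [hμ1] at hrel
  exact ⟨μ z x u, hz, hrel⟩
end

section
/- Let (M, μ) be a topological Mal'tsev algebra and let ~ be a congruence on (M, μ). Endow the quotient set M/~ with the quotient topology and with the induced ternary operation μ̄([x],[y],[z]) = [μ(x,y,z)] (which is well defined since ~ is a congruence). Then μ̄ is continuous, so M/~ is a topological Mal'tsev algebra, and the canonical projection M → M/~ is a continuous open map. -/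
/-- The projection of a Mal'tsev algebra onto its quotient by a congruence is open as soon as the
operation is continuous in its first variable. -/
theorem isOpenMap_quotient_mk_of_maltsev {M : Type*} [TopologicalSpace M]
    (μ : M → M → M → M) (hμc : ∀ y z : M, Continuous fun x => μ x y z)
    (hμ1 : ∀ x y : M, μ x y y = x) (hμ2 : ∀ x y : M, μ y y x = x) (s : Setoid M)
    (hcong : ∀ x₁ y₁ x₂ y₂ x₃ y₃ : M, s.r x₁ y₁ → s.r x₂ y₂ → s.r x₃ y₃ →
      s.r (μ x₁ x₂ x₃) (μ y₁ y₂ y₃)) :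
    IsOpenMap (Quotient.mk s) := by
  intro U hU
  refine isQuotientMap_quotient_mk'.isOpen_preimage.mp (isOpen_iff_mem_nhds.mpr ?_)
  rintro y ⟨x, hx, hxy⟩
  have hmem : (fun z => μ z y x) ⁻¹' U ∈ nhds y :=
    (hU.preimage (hμc y x)).mem_nhds (by simpa [hμ2] using hx)
  filter_upwards [hmem] with z hz
  refine ⟨μ z y x, hz, Quotient.sound ?_⟩
  have h := hcong z z y y x y (s.refl z) (s.refl y) (Quotient.exact hxy)
  rwa [hμ1] at h


/-- The topological quotient of a topological Mal'tsev algebra by a congruence is a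
topological Mal'tsev algebra, and the canonical projection is continuous and open. -/
theorem maltsev_quotient_topological {M : Type*} [TopologicalSpace M]
    (μ : M → M → M → M)
    (hμc : Continuous fun p : M × M × M => μ p.1 p.2.1 p.2.2)
    (hμ1 : ∀ x y : M, μ x y y = x) (hμ2 : ∀ x y : M, μ y y x = x)
    (s : Setoid M)
    (hcong : ∀ x₁ y₁ x₂ y₂ x₃ y₃ : M, s.r x₁ y₁ → s.r x₂ y₂ → s.r x₃ y₃ →
      s.r (μ x₁ x₂ x₃) (μ y₁ y₂ y₃)) :
    ∃ μbar : Quotient s → Quotient s → Quotient s → Quotient s,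
      (∀ x y z : M, μbar (Quotient.mk s x) (Quotient.mk s y) (Quotient.mk s z) =
        Quotient.mk s (μ x y z)) ∧
      Continuous (fun p : Quotient s × Quotient s × Quotient s => μbar p.1 p.2.1 p.2.2) ∧
      (∀ a b : Quotient s, μbar a b b = a) ∧
      (∀ a b : Quotient s, μbar b b a = a) ∧
      Continuous (Quotient.mk s) ∧
      IsOpenMap (Quotient.mk s) := by
  have hopen : IsOpenMap (Quotient.mk s) :=
    isOpenMap_quotient_mk_of_maltsev μ
      (fun y z => hμc.comp (f := fun x => (x, y, z)) (by fun_prop)) hμ1 hμ2 s hcong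
  have hcont : Continuous (Quotient.mk s) := continuous_quot_mk
  have hquot : IsOpenQuotientMap (Quotient.mk s) := ⟨Quotient.mk_surjective, hcont, hopen⟩
  refine ⟨fun a b c => Quotient.liftOn₂ a b
    (fun x y => Quotient.liftOn c (fun z => Quotient.mk s (μ x y z)) ?_) ?_,
    fun _ _ _ => rfl, ?_, ?_, ?_, hcont, hopen⟩
  · exact fun z w h => Quotient.sound (hcong _ _ _ _ _ _ (s.refl x) (s.refl y) h)
  · intro x y x' y' hx hy
    induction c using Quotient.inductionOn with
    | h z => exact Quotient.sound (hcong _ _ _ _ _ _ hx hy (s.refl z))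
  · exact (hquot.prodMap (hquot.prodMap hquot)).isQuotientMap.continuous_iff.mpr (hcont.comp hμc)
  · rintro ⟨x⟩ ⟨y⟩
    exact congrArg (Quotient.mk s) (hμ1 x y)
  · rintro ⟨x⟩ ⟨y⟩
    exact congrArg (Quotient.mk s) (hμ2 x y)
end

section
/- Every topological Mal'tsev algebra whose underlying topological space satisfies the T₀ separation axiom is Hausdorff. -/
/-- In a topological Mal'tsev algebra, points without disjoint neighbourhoods are related by
specialization: if `z` tends to both `a` and `b`, then the constant `b = μ z z b` tends to
`μ a b b = a`. -/
theorem specializes_of_maltsev {M : Type*} [TopologicalSpace M]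
    (μ : M → M → M → M)
    (hμc : Continuous fun p : M × M × M => μ p.1 p.2.1 p.2.2)
    (hμ1 : ∀ x y : M, μ x y y = x) (hμ2 : ∀ x y : M, μ y y x = x)
    {a b : M} (h : (nhds a ⊓ nhds b).NeBot) : b ⤳ a := by
  have ha : Filter.Tendsto id (nhds a ⊓ nhds b) (nhds a) := inf_le_left
  have hb : Filter.Tendsto id (nhds a ⊓ nhds b) (nhds b) := inf_le_right
  have key := (hμc.tendsto (a, b, b)).comp
    (ha.prodMk_nhds (hb.prodMk_nhds (tendsto_const_nhds (x := b))))
  simp only [Function.comp_def, id, hμ1, hμ2] at key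
  rw [specializes_iff_forall_open]
  intro s hs has
  exact (key.eventually (hs.mem_nhds has)).exists.choose_spec

/-- Every T₀ topological Mal'tsev algebra is Hausdorff. -/
theorem t0_maltsev_t2 {M : Type*} [TopologicalSpace M] [T0Space M]
    (μ : M → M → M → M)
    (hμc : Continuous fun p : M × M × M => μ p.1 p.2.1 p.2.2)
    (hμ1 : ∀ x y : M, μ x y y = x) (hμ2 : ∀ x y : M, μ y y x = x) :
    T2Space M := by
  rw [t2_iff_nhds]
  intro a b h
  have hab : b ⤳ a := specializes_of_maltsev μ hμc hμ1 hμ2 h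
  have hba : a ⤳ b := specializes_of_maltsev μ hμc hμ1 hμ2 (inf_comm (nhds a) (nhds b) ▸ h)
  exact (hba.antisymm hab).eq
end

section
/- Every T₀ topological quasigroup is regular (hence a T₃ space). -/
/-- Every T₀ topological quasigroup is regular (hence T₃). -/
theorem t0_topological_quasigroup_regular {Q : Type*} [TopologicalSpace Q] [T0Space Q]
    (mul div ldiv : Q → Q → Q)
    (hmulc : Continuous fun p : Q × Q => mul p.1 p.2)
    (hdivc : Continuous fun p : Q × Q => div p.1 p.2)
    (hldivc : Continuous fun p : Q × Q => ldiv p.1 p.2)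
    (h1 : ∀ x y : Q, mul (div y x) x = y)
    (h2 : ∀ x y : Q, div (mul y x) x = y)
    (h3 : ∀ x y : Q, mul x (ldiv x y) = y)
    (h4 : ∀ x y : Q, ldiv x (mul x y) = y) :
    RegularSpace Q ∧ T3Space Q := by
  have hreg : RegularSpace Q := by
    refine .of_exists_mem_nhds_isClosed_subset fun x N hN => ?_
    have hcont : Continuous fun p : Q × Q => mul (div p.1 p.2) x :=
      hmulc.comp (hdivc.prodMk continuous_const)
    have hpre : (fun p : Q × Q => mul (div p.1 p.2) x) ⁻¹' N ∈ nhds (x, x) :=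
      hcont.continuousAt.preimage_mem_nhds (by simpa only [h1] using hN)
    obtain ⟨V, hV, W, hW, hVW⟩ := mem_nhds_prod_iff.mp hpre
    refine ⟨closure V, Filter.mem_of_superset hV subset_closure, isClosed_closure, ?_⟩
    intro y hy
    -- The left translation by `y / x` carries `x` to `y`, and `z ↦ (y / x) \ z` inverts it.
    have htrans : Continuous fun z => ldiv (div y x) z :=
      hldivc.comp (continuous_const.prodMk continuous_id)
    have hyx : ldiv (div y x) y = x := by
      conv_lhs => rw [← h1 x y, h2, h4]
    have hWy : (fun z => ldiv (div y x) z) ⁻¹' W ∈ nhds y :=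
      htrans.continuousAt.preimage_mem_nhds (by simpa only [hyx] using hW)
    obtain ⟨v, hvW, hvV⟩ := mem_closure_iff_nhds.mp hy _ hWy
    have hv : div v (ldiv (div y x) v) = div y x := by
      conv_lhs => rw [← h3 (div y x) v, h4, h2]
    have hmem : mul (div v (ldiv (div y x) v)) x ∈ N := hVW (Set.mk_mem_prod hvV hvW)
    rwa [hv, h1] at hmem
  exact ⟨hreg, inferInstance⟩
end

section
/- Every T₀ topological left loop is regular (hence a T₃ space). -/
open Topology

/-- Every T₀ topological left loop is regular (hence T₃). -/
theorem t0_topological_left_loop_regular {L : Type*} [TopologicalSpace L] [T0Space L]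
    (mul ldiv : L → L → L) (e : L)
    (hmulc : Continuous fun p : L × L => mul p.1 p.2)
    (hldivc : Continuous fun p : L × L => ldiv p.1 p.2)
    (h1 : ∀ x y : L, mul x (ldiv x y) = y)
    (h2 : ∀ x y : L, ldiv x (mul x y) = y)
    (h3 : ∀ x : L, mul x e = x) :
    RegularSpace L ∧ T3Space L := by
  have hself (x : L) : ldiv x x = e := by
    have := h2 x e
    rwa [h3] at this
  have hreg : RegularSpace L := by
    refine RegularSpace.of_exists_mem_nhds_isClosed_subset fun x s hs => ?_
    have hpre : (fun p : L × L => mul p.1 p.2) ⁻¹' s ∈ 𝓝 (x, e) :=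
      hmulc.continuousAt.preimage_mem_nhds (by simpa [h3] using hs)
    obtain ⟨V, hV, W, hW, hVW⟩ := mem_nhds_prod_iff.mp hpre
    refine ⟨closure V, Filter.mem_of_superset hV subset_closure, isClosed_closure, fun y hy => ?_⟩
    have hc : Continuous fun v => ldiv v y := hldivc.comp (continuous_id.prodMk continuous_const)
    have hN : (fun v => ldiv v y) ⁻¹' W ∈ 𝓝 y :=
      hc.continuousAt.preimage_mem_nhds (by rwa [hself])
    obtain ⟨v, hvW, hvV⟩ := mem_closure_iff_nhds.mp hy _ hN
    have hmem : mul v (ldiv v y) ∈ s := hVW (Set.mk_mem_prod hvV hvW)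
    rwa [h1] at hmem
  exact ⟨hreg, inferInstance⟩
end

section
/- Let (M, μ) be a topological Mal'tsev algebra and let θ be a congruence on (M, μ). Then the following conditions are equivalent: (i) the quotient space M/θ with the quotient topology is Hausdorff; (ii) every equivalence class of θ is closed in M; (iii) θ is closed as a subset of M × M. -/
/-- The quotient map of a topological Mal'tsev algebra by a congruence is open. -/
theorem maltsev_isOpenQuotientMap_mk {M : Type*} [TopologicalSpace M]
    (μ : M → M → M → M)
    (hμc : Continuous fun p : M × M × M => μ p.1 p.2.1 p.2.2)
    (hμ1 : ∀ x y : M, μ x y y = x) (hμ2 : ∀ x y : M, μ y y x = x)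
    (s : Setoid M)
    (hcong : ∀ x₁ y₁ x₂ y₂ x₃ y₃ : M, s.r x₁ y₁ → s.r x₂ y₂ → s.r x₃ y₃ →
      s.r (μ x₁ x₂ x₃) (μ y₁ y₂ y₃)) :
    IsOpenQuotientMap (Quotient.mk s) := by
  refine ⟨Quotient.mk_surjective, continuous_quotient_mk', fun U hU => ?_⟩
  refine isOpen_coinduced.2 (isOpen_iff_mem_nhds.2 ?_)
  rintro z ⟨u, hu, huz⟩
  have hc : Continuous fun t : M => μ t z u :=
    hμc.comp (continuous_id.prodMk (continuous_const (y := (z, u))))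
  have hz : (fun t : M => μ t z u) ⁻¹' U ∈ nhds z :=
    (hU.preimage hc).mem_nhds (by simpa [hμ2] using hu)
  filter_upwards [hz] with t ht
  refine ⟨μ t z u, ht, Quotient.sound ?_⟩
  have h := hcong t t z z u z (s.refl t) (s.refl z) (Quotient.exact huz)
  rwa [hμ1] at h

/-- A congruence of a topological Mal'tsev algebra with closed classes is closed. -/
theorem maltsev_isClosed_of_isClosed_classes {M : Type*} [TopologicalSpace M]
    (μ : M → M → M → M)
    (hμc : Continuous fun p : M × M × M => μ p.1 p.2.1 p.2.2)
    (hμ1 : ∀ x y : M, μ x y y = x) (hμ2 : ∀ x y : M, μ y y x = x)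
    (s : Setoid M)
    (hcong : ∀ x₁ y₁ x₂ y₂ x₃ y₃ : M, s.r x₁ y₁ → s.r x₂ y₂ → s.r x₃ y₃ →
      s.r (μ x₁ x₂ x₃) (μ y₁ y₂ y₃))
    (hs : ∀ x : M, IsClosed {y : M | s.r x y}) :
    IsClosed {p : M × M | s.r p.1 p.2} := by
  refine isClosed_of_closure_subset ?_
  rintro ⟨a, b⟩ hab
  have hc : Continuous fun p : M × M => μ p.1 p.2 b :=
    hμc.comp (continuous_fst.prodMk (continuous_snd.prodMk continuous_const))
  have hsub : {p : M × M | s.r p.1 p.2} ⊆ (fun p : M × M => μ p.1 p.2 b) ⁻¹' {y | s.r b y} := by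
    rintro ⟨x, y⟩ hxy
    have h := hcong x y y y b b hxy (s.refl y) (s.refl b)
    rw [hμ2] at h
    exact s.symm h
  have h := closure_minimal hsub ((hs b).preimage hc) hab
  have h' : s.r b (μ a b b) := h
  rw [hμ1] at h'
  exact s.symm h'

/-- Theorem D for Mal'tsev algebras: for a congruence θ on a topological Mal'tsev algebra M,
the quotient M/θ is Hausdorff iff all equivalence classes of θ are closed iff θ is closed
in M × M. -/
theorem maltsev_quotient_hausdorff_iff {M : Type*} [TopologicalSpace M]
    (μ : M → M → M → M)
    (hμc : Continuous fun p : M × M × M => μ p.1 p.2.1 p.2.2)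
    (hμ1 : ∀ x y : M, μ x y y = x) (hμ2 : ∀ x y : M, μ y y x = x)
    (s : Setoid M)
    (hcong : ∀ x₁ y₁ x₂ y₂ x₃ y₃ : M, s.r x₁ y₁ → s.r x₂ y₂ → s.r x₃ y₃ →
      s.r (μ x₁ x₂ x₃) (μ y₁ y₂ y₃)) :
    (T2Space (Quotient s) ↔ ∀ x : M, IsClosed {y : M | s.r x y}) ∧
    (T2Space (Quotient s) ↔ IsClosed {p : M × M | s.r p.1 p.2}) := by
  have hT2 : T2Space (Quotient s) ↔ IsClosed {p : M × M | s.r p.1 p.2} := by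
    rw [t2Space_iff_of_isOpenQuotientMap (maltsev_isOpenQuotientMap_mk μ hμc hμ1 hμ2 s hcong)]
    simp only [Quotient.eq]
  refine ⟨hT2.trans ⟨fun h x => ?_, ?_⟩, hT2⟩
  · exact h.preimage (Continuous.prodMk_right x)
  · exact maltsev_isClosed_of_isClosed_classes μ hμc hμ1 hμ2 s hcong
end

section
/- Let (B, μ) be a topological Mal'tsev algebra, let A ⊆ B be a subset closed under μ (i.e. μ(A × A × A) ⊆ A), and let θ ⊆ A × A be a congruence on the Mal'tsev algebra A. Then the closure of θ in B × B is a congruence on the closure of A in B (note that the closure of A is again closed under μ): the closure of θ is an equivalence relation on cl(A) compatible with μ. -/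
/-- A continuous ternary map sending `s × t × u` into `v` sends
`closure s × closure t × closure u` into `closure v`. -/
theorem map_mem_closure_of_ternary {X Y Z W : Type*} [TopologicalSpace X] [TopologicalSpace Y]
    [TopologicalSpace Z] [TopologicalSpace W] {f : X → Y → Z → W}
    (hf : Continuous fun p : X × Y × Z => f p.1 p.2.1 p.2.2)
    {s : Set X} {t : Set Y} {u : Set Z} {v : Set W}
    (h : ∀ a ∈ s, ∀ b ∈ t, ∀ c ∈ u, f a b c ∈ v)
    {a : X} {b : Y} {c : Z} (ha : a ∈ closure s) (hb : b ∈ closure t) (hc : c ∈ closure u) :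
    f a b c ∈ closure v := by
  have habc : (a, b, c) ∈ closure (s ×ˢ t ×ˢ u) := by
    rw [closure_prod_eq, closure_prod_eq]
    exact ⟨ha, hb, hc⟩
  exact map_mem_closure (f := fun p : X × Y × Z => f p.1 p.2.1 p.2.2) hf habc
    fun p hp => h p.1 hp.1 p.2.1 hp.2.1 p.2.2 hp.2.2

/-- Theorem D (final assertion) for Mal'tsev algebras: if A is a subalgebra of a topological
Mal'tsev algebra B and θ ⊆ A × A is a congruence on A, then the closure of A is again a
subalgebra and the closure of θ in B × B is a congruence on the closure of A. -/
theorem maltsev_closure_of_congruence {B : Type*} [TopologicalSpace B]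
    (μ : B → B → B → B)
    (hμc : Continuous fun p : B × B × B => μ p.1 p.2.1 p.2.2)
    (hμ1 : ∀ x y : B, μ x y y = x) (hμ2 : ∀ x y : B, μ y y x = x)
    (A : Set B)
    (hA : ∀ a ∈ A, ∀ b ∈ A, ∀ c ∈ A, μ a b c ∈ A)
    (θ : Set (B × B)) (hθA : θ ⊆ A ×ˢ A)
    (hrefl : ∀ a ∈ A, (a, a) ∈ θ)
    (hsymm : ∀ p ∈ θ, (Prod.snd p, Prod.fst p) ∈ θ)
    (htrans : ∀ x y z : B, (x, y) ∈ θ → (y, z) ∈ θ → (x, z) ∈ θ)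
    (hcong : ∀ x₁ y₁ x₂ y₂ x₃ y₃ : B, (x₁, y₁) ∈ θ → (x₂, y₂) ∈ θ → (x₃, y₃) ∈ θ →
      (μ x₁ x₂ x₃, μ y₁ y₂ y₃) ∈ θ) :
    (∀ a ∈ closure A, ∀ b ∈ closure A, ∀ c ∈ closure A, μ a b c ∈ closure A) ∧
    closure θ ⊆ closure A ×ˢ closure A ∧
    (∀ a ∈ closure A, (a, a) ∈ closure θ) ∧
    (∀ p ∈ closure θ, (Prod.snd p, Prod.fst p) ∈ closure θ) ∧
    (∀ x y z : B, (x, y) ∈ closure θ → (y, z) ∈ closure θ → (x, z) ∈ closure θ) ∧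
    (∀ x₁ y₁ x₂ y₂ x₃ y₃ : B,
      (x₁, y₁) ∈ closure θ → (x₂, y₂) ∈ closure θ → (x₃, y₃) ∈ closure θ →
      (μ x₁ x₂ x₃, μ y₁ y₂ y₃) ∈ closure θ) := by
  have hsub : closure θ ⊆ closure A ×ˢ closure A := by
    rw [← closure_prod_eq]
    exact closure_mono hθA
  have hrefl_closure : ∀ a ∈ closure A, (a, a) ∈ closure θ := fun a ha =>
    map_mem_closure (f := fun a : B => (a, a)) (by fun_prop) ha hrefl
  have hcong_closure : ∀ x₁ y₁ x₂ y₂ x₃ y₃ : B,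
      (x₁, y₁) ∈ closure θ → (x₂, y₂) ∈ closure θ → (x₃, y₃) ∈ closure θ →
      (μ x₁ x₂ x₃, μ y₁ y₂ y₃) ∈ closure θ := by
    intro x₁ y₁ x₂ y₂ x₃ y₃ h₁ h₂ h₃
    have hcont : Continuous fun p : (B × B) × (B × B) × (B × B) =>
        (μ p.1.1 p.2.1.1 p.2.2.1, μ p.1.2 p.2.1.2 p.2.2.2) :=
      (hμc.comp (g := fun p : B × B × B => μ p.1 p.2.1 p.2.2)
        (f := fun p : (B × B) × (B × B) × (B × B) => (p.1.1, p.2.1.1, p.2.2.1))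
        (by fun_prop)).prodMk
      (hμc.comp (g := fun p : B × B × B => μ p.1 p.2.1 p.2.2)
        (f := fun p : (B × B) × (B × B) × (B × B) => (p.1.2, p.2.1.2, p.2.2.2))
        (by fun_prop))
    exact map_mem_closure_of_ternary
      (f := fun p q r : B × B => (μ p.1 q.1 r.1, μ p.2 q.2 r.2)) hcont
      (fun p hp q hq r hr => hcong p.1 p.2 q.1 q.2 r.1 r.2 hp hq hr) h₁ h₂ h₃
  refine ⟨fun a ha b hb c hc => map_mem_closure_of_ternary hμc hA ha hb hc, hsub,
    hrefl_closure, fun p hp => map_mem_closure (f := Prod.swap) continuous_swap hp hsymm,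
    ?_, hcong_closure⟩
  -- Apply `μ` to the pairs `(x, y)`, `(y, y)`, `(y, z)`.
  intro x y z hxy hyz
  simpa only [hμ1, hμ2] using
    hcong_closure x y y y y z hxy (hrefl_closure y (hsub hxy).2) hyz
end

section
/- For every topological space X there exists a free topological Mal'tsev algebra on X, i.e. a topological Mal'tsev algebra (M, μ) together with a continuous map i : X → M such that the only subset of M containing i(X) and closed under μ is M itself, and for every topological Mal'tsev algebra (N, ν) and every continuous map f : X → N there exists a (necessarily unique) continuous μ-homomorphism h : M → N with h ∘ i = f. -/
universe u

/-- `μ` is a continuous Mal'tsev operation on the topological space `M`. -/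
def IsContMaltsevOp {M : Type u} [TopologicalSpace M] (μ : M → M → M → M) : Prop :=
  Continuous (fun p : M × M × M => μ p.1 p.2.1 p.2.2) ∧
  (∀ x y : M, μ x y y = x) ∧ (∀ x y : M, μ y y x = x)

/-- `(M, μ, i)` is a free topological Mal'tsev algebra on the topological space `X`:
`μ` is a continuous Mal'tsev operation, `i` is continuous, `i(X)` generates `M`
(no proper subset of `M` containing `i(X)` is closed under `μ`), and every continuous
map from `X` to a topological Mal'tsev algebra extends to a continuous homomorphism of `M`. -/
def IsFreeTopMaltsev (X : Type u) [TopologicalSpace X] (M : Type u) [TopologicalSpace M]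
    (μ : M → M → M → M) (i : X → M) : Prop :=
  IsContMaltsevOp μ ∧ Continuous i ∧
  (∀ S : Set M, Set.range i ⊆ S → (∀ a ∈ S, ∀ b ∈ S, ∀ c ∈ S, μ a b c ∈ S) →
    S = Set.univ) ∧
  (∀ (N : Type u) [TopologicalSpace N] (ν : N → N → N → N), IsContMaltsevOp ν →
    ∀ f : X → N, Continuous f →
      ∃ h : M → N, Continuous h ∧ (∀ a b c : M, h (μ a b c) = ν (h a) (h b) (h c)) ∧
        h ∘ i = f)

/-- Terms in one ternary operation symbol over the variables `X`. -/
inductive MaltsevTerm (X : Type u) : Type u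
  | of : X → MaltsevTerm X
  | op : MaltsevTerm X → MaltsevTerm X → MaltsevTerm X → MaltsevTerm X

namespace MaltsevTerm

variable {X : Type u}

/-- One-step rewriting of terms by the Mal'tsev identities. -/
inductive Rel : MaltsevTerm X → MaltsevTerm X → Prop
  | right (x y : MaltsevTerm X) : Rel (op x y y) x
  | left (x y : MaltsevTerm X) : Rel (op y y x) x
  | congr_fst {a a' : MaltsevTerm X} (b c : MaltsevTerm X) :
      Rel a a' → Rel (op a b c) (op a' b c)
  | congr_snd (a : MaltsevTerm X) {b b' : MaltsevTerm X} (c : MaltsevTerm X) :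
      Rel b b' → Rel (op a b c) (op a b' c)
  | congr_thd (a b : MaltsevTerm X) {c c' : MaltsevTerm X} :
      Rel c c' → Rel (op a b c) (op a b c')

/-- Evaluation of terms in an algebra with a ternary operation. -/
def eval {N : Type*} (ν : N → N → N → N) (f : X → N) : MaltsevTerm X → N
  | of x => f x
  | op a b c => ν (eval ν f a) (eval ν f b) (eval ν f c)

theorem Rel.eval_eq {N : Type*} {ν : N → N → N → N} (hr : ∀ x y, ν x y y = x)
    (hl : ∀ x y, ν y y x = x) (f : X → N) {a b : MaltsevTerm X} (h : Rel a b) :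
    eval ν f a = eval ν f b := by
  induction h <;> simp_all [eval]

end MaltsevTerm

/-- The free Mal'tsev algebra on a set. -/
def FreeMaltsev (X : Type u) : Type u := Quot (MaltsevTerm.Rel (X := X))

theorem continuous_comp_prodMap₃ {A B C : Type*} {tA : TopologicalSpace A}
    {tB : TopologicalSpace B} [TopologicalSpace C] {g : A → B} (hg : Continuous g)
    {F : B × B × B → C} (hF : Continuous F) :
    Continuous fun p : A × A × A => F (g p.1, g p.2.1, g p.2.2) :=
  hF.comp (hg.prodMap (hg.prodMap hg))

namespace FreeMaltsev

variable {X : Type u}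

/-- The inclusion of the generators. -/
def of (x : X) : FreeMaltsev X := Quot.mk _ (.of x)

/-- The Mal'tsev operation of the free Mal'tsev algebra. -/
def op (a b c : FreeMaltsev X) : FreeMaltsev X :=
  Quot.lift
    (fun s => Quot.map₂ (MaltsevTerm.op s) (fun t _ _ h => .congr_thd s t h)
      (fun _ _ u h => .congr_snd s u h))
    (fun s s' h => by
      funext b c
      induction b using Quot.ind
      induction c using Quot.ind
      exact Quot.sound (.congr_fst _ _ h)) a b c

theorem op_right (x y : FreeMaltsev X) : op x y y = x := by
  induction x using Quot.ind
  induction y using Quot.ind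
  exact Quot.sound (.right _ _)

theorem op_left (x y : FreeMaltsev X) : op y y x = x := by
  induction x using Quot.ind
  induction y using Quot.ind
  exact Quot.sound (.left _ _)

theorem eq_univ_of_closed {S : Set (FreeMaltsev X)} (hof : Set.range of ⊆ S)
    (hop : ∀ a ∈ S, ∀ b ∈ S, ∀ c ∈ S, op a b c ∈ S) : S = Set.univ := by
  refine Set.eq_univ_of_forall fun a => ?_
  induction a using Quot.ind with
  | mk t =>
    induction t with
    | of x => exact hof ⟨x, rfl⟩
    | op a b c ha hb hc => exact hop _ ha _ hb _ hc

/-- The homomorphic extension of a map to a Mal'tsev algebra. -/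
def lift {N : Type*} (ν : N → N → N → N) (hr : ∀ x y, ν x y y = x)
    (hl : ∀ x y, ν y y x = x) (f : X → N) : FreeMaltsev X → N :=
  Quot.lift (MaltsevTerm.eval ν f) fun _ _ h => h.eval_eq hr hl f

theorem lift_op {N : Type*} {ν : N → N → N → N} (hr : ∀ x y, ν x y y = x)
    (hl : ∀ x y, ν y y x = x) (f : X → N) (a b c : FreeMaltsev X) :
    lift ν hr hl f (op a b c) = ν (lift ν hr hl f a) (lift ν hr hl f b) (lift ν hr hl f c) := by
  induction a using Quot.ind
  induction b using Quot.ind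
  induction c using Quot.ind
  rfl

/-- The topologies on the free Mal'tsev algebra for which the operation and the inclusion of
the generators are continuous. -/
def admissibleTopologies (X : Type u) [TopologicalSpace X] :
    Set (TopologicalSpace (FreeMaltsev X)) :=
  {_t | Continuous (fun p : FreeMaltsev X × FreeMaltsev X × FreeMaltsev X =>
    op p.1 p.2.1 p.2.2) ∧ Continuous (of : X → FreeMaltsev X)}

/-- The finest admissible topology. -/
instance [TopologicalSpace X] : TopologicalSpace (FreeMaltsev X) :=
  sInf (admissibleTopologies X)

theorem continuous_of [TopologicalSpace X] : Continuous (of : X → FreeMaltsev X) :=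
  continuous_sInf_rng.2 fun _ ht => ht.2

theorem continuous_op [TopologicalSpace X] :
    Continuous (fun p : FreeMaltsev X × FreeMaltsev X × FreeMaltsev X => op p.1 p.2.1 p.2.2) := by
  refine continuous_sInf_rng.2 fun t ht => ?_
  exact continuous_comp_prodMap₃ (tA := sInf (admissibleTopologies X)) (tB := t)
    (continuous_id_of_le (sInf_le ht)) ht.1

theorem continuous_lift [TopologicalSpace X] {N : Type*} [TopologicalSpace N]
    {ν : N → N → N → N} (hν : Continuous (fun p : N × N × N => ν p.1 p.2.1 p.2.2))
    (hr : ∀ x y, ν x y y = x) (hl : ∀ x y, ν y y x = x) {f : X → N} (hf : Continuous f) :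
    Continuous (lift ν hr hl f) := by
  refine continuous_sInf_dom (t := .induced (lift ν hr hl f) ‹_›) ?_ continuous_induced_dom
  let _ : TopologicalSpace (FreeMaltsev X) := .induced (lift ν hr hl f) ‹_›
  have hc : Continuous (lift ν hr hl f) := continuous_induced_dom
  refine ⟨continuous_induced_rng.2 ?_, continuous_induced_rng.2 hf⟩
  simp only [Function.comp_def, lift_op]
  exact continuous_comp_prodMap₃ hc hν

end FreeMaltsev

/-- Theorem 1(1): the free topological Mal'tsev algebra exists on every topological space. -/
theorem free_topological_maltsev_exists (X : Type u) [TopologicalSpace X] :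
    ∃ (M : Type u) (tM : TopologicalSpace M) (μ : M → M → M → M) (i : X → M),
      @IsFreeTopMaltsev X _ M tM μ i :=
  ⟨FreeMaltsev X, inferInstance, FreeMaltsev.op, FreeMaltsev.of,
    ⟨FreeMaltsev.continuous_op, FreeMaltsev.op_right, FreeMaltsev.op_left⟩,
    FreeMaltsev.continuous_of,
    fun _ => FreeMaltsev.eq_univ_of_closed,
    fun _ _ ν hν f hf => ⟨FreeMaltsev.lift ν hν.2.1 hν.2.2 f,
      FreeMaltsev.continuous_lift hν.1 hν.2.1 hν.2.2 hf,
      FreeMaltsev.lift_op hν.2.1 hν.2.2 f, rfl⟩⟩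
end

section
/- Let X be a topological space and let (M, μ, i) be a free topological Mal'tsev algebra on X. Then the map i : X → M is injective, and M is freely generated by i(X): for every Mal'tsev algebra (N, ν) (with no topology assumed, i.e. ν : N × N × N → N satisfies ν(x,y,y) = x = ν(y,y,x)) and every function f : X → N there exists a unique μ-homomorphism h : M → N with h ∘ i = f. -/
universe u

/-- Theorem 1(2): the canonical map `i` of a free topological Mal'tsev algebra is injective,
and `M` is freely generated by `i(X)` as an abstract Mal'tsev algebra: every map from `X`
to an abstract Mal'tsev algebra extends uniquely to a homomorphism. -/
theorem free_topological_maltsev_injective_and_abstractly_free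
    (X : Type u) [TopologicalSpace X] (M : Type u) [TopologicalSpace M]
    (μ : M → M → M → M) (i : X → M)
    (hfree : IsFreeTopMaltsev X M μ i) :
    Function.Injective i ∧
    ∀ (N : Type u) (ν : N → N → N → N),
      (∀ x y : N, ν x y y = x) → (∀ x y : N, ν y y x = x) →
      ∀ f : X → N,
        ∃! h : M → N, (∀ a b c : M, h (μ a b c) = ν (h a) (h b) (h c)) ∧ h ∘ i = f := by
  classical
  obtain ⟨-, -, hgen, hext⟩ := hfree
  have exists_hom (N : Type u) (ν : N → N → N → N) (hr : ∀ x y, ν x y y = x)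
      (hl : ∀ x y, ν y y x = x) (f : X → N) :
      ∃ h : M → N, (∀ a b c, h (μ a b c) = ν (h a) (h b) (h c)) ∧ h ∘ i = f := by
    -- Every map into a space with the indiscrete topology is continuous.
    let _ : TopologicalSpace N := ⊤
    obtain ⟨h, -, hh⟩ := hext N ν ⟨continuous_top, hr, hl⟩ f continuous_top
    exact ⟨h, hh⟩
  refine ⟨?_, fun N ν hr hl f ↦ ?_⟩
  · obtain ⟨h, -, hi⟩ := exists_hom X (fun x y z ↦ if x = y then z else x)
      (fun x y ↦ by split_ifs with hxy <;> simp [hxy]) (fun x y ↦ by simp) id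
    exact (Function.leftInverse_iff_comp.mpr hi).injective
  · obtain ⟨h, hμ, hi⟩ := exists_hom N ν hr hl f
    refine ⟨h, ⟨hμ, hi⟩, fun g ⟨gμ, gi⟩ ↦ ?_⟩
    have key : {m | g m = h m} = Set.univ := by
      refine hgen _ ?_ fun a ha b hb c hc ↦ ?_
      · rintro _ ⟨x, rfl⟩
        exact congrFun (gi.trans hi.symm) x
      · simp_all only [Set.mem_ofPred_eq]
    exact funext fun m ↦ Set.eq_univ_iff_forall.mp key m
end

section
/- Let (N, ν) be a topological Mal'tsev algebra and let (M, μ, i) be a free topological Mal'tsev algebra on the topological space N. Then there exists a continuous μ-homomorphism h : M → N that is surjective, open, and satisfies h ∘ i = id_N; in particular, i is a homeomorphic embedding, h is a retraction onto i(N) (after identifying N with i(N)), and N is a topological quotient of M. -/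
universe u

/-- Theorem 1(3): every topological Mal'tsev algebra `N` is the image of the free
topological Mal'tsev algebra `M(N)` on (the space) `N` under an open continuous surjective
homomorphism which is a retraction; in particular `i` is an embedding and `N` is a
topological quotient of `M(N)`. -/
theorem maltsev_algebra_is_quotient_of_free
    (N : Type u) [TopologicalSpace N] (ν : N → N → N → N) (hν : IsContMaltsevOp ν)
    (M : Type u) [TopologicalSpace M] (μ : M → M → M → M) (i : N → M)
    (hfree : IsFreeTopMaltsev N M μ i) :
    ∃ h : M → N, Continuous h ∧ (∀ a b c : M, h (μ a b c) = ν (h a) (h b) (h c)) ∧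
      Function.Surjective h ∧ IsOpenMap h ∧ h ∘ i = id ∧
      Topology.IsEmbedding i ∧ Topology.IsQuotientMap h := by
  obtain ⟨⟨hμc, hμr, -⟩, hi, -, huniv⟩ := hfree
  obtain ⟨h, hc, hhom, hid⟩ := huniv N ν hν id continuous_id
  have hinv : Function.LeftInverse h i := congrFun hid
  have hopen : IsOpenMap h := by
    refine IsOpenMap.of_sections fun u =>
      ⟨fun n => μ u (i (h u)) (i n), ?_, hμr u _, fun n => ?_⟩
    · exact (hμc.comp (by fun_prop : Continuous fun n => (u, i (h u), i n))).continuousAt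
    · rw [hhom, hinv, hinv, hν.2.2]
  exact ⟨h, hc, hhom, hinv.surjective, hopen, hid, hinv.isEmbedding hc hi,
    hopen.isQuotientMap hc hinv.surjective⟩
end

section
/- Let X and Y be topological spaces, let (M_X, μ_X, i_X) and (M_Y, μ_Y, i_Y) be free topological Mal'tsev algebras on X and Y respectively, and let f : X → Y be a continuous map. Then there exists a unique continuous μ-homomorphism h : M_X → M_Y with i_Y ∘ f = h ∘ i_X. Moreover, if the induced map i_X(X) → i_Y(Y), i_X(x) ↦ i_Y(f(x)) (with the subspace topologies) is a quotient map, then h is an open map. -/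
universe u

open Topology

/-- The saturation of an open set under the kernel of a homomorphism of Mal'tsev algebras
is open. -/
theorem IsContMaltsevOp.isOpen_preimage_image {M : Type u} [TopologicalSpace M]
    {μ : M → M → M → M} (hμ : IsContMaltsevOp μ) {N : Type u} {ν : N → N → N → N}
    (hν : ∀ x y : N, ν x y y = x) {h : M → N}
    (hom : ∀ a b c : M, h (μ a b c) = ν (h a) (h b) (h c)) {U : Set M} (hU : IsOpen U) :
    IsOpen (h ⁻¹' (h '' U)) := by
  rw [isOpen_iff_mem_nhds]
  rintro y ⟨u, hu, huy⟩
  have hcont : Continuous fun z : M => μ z y u :=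
    hμ.1.comp (by fun_prop : Continuous fun z : M => (z, y, u))
  have hy : μ y y u ∈ U := by rwa [hμ.2.2]
  filter_upwards [(hU.preimage hcont).mem_nhds hy] with z hz
  exact ⟨μ z y u, hz, by rw [hom, huy, hν]⟩

/-- A quotient homomorphism out of a topological Mal'tsev algebra is open. -/
theorem IsContMaltsevOp.isOpenMap_of_isQuotientMap {M : Type u} [TopologicalSpace M]
    {μ : M → M → M → M} (hμ : IsContMaltsevOp μ) {N : Type u} [TopologicalSpace N]
    {ν : N → N → N → N} (hν : ∀ x y : N, ν x y y = x) {h : M → N}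
    (hom : ∀ a b c : M, h (μ a b c) = ν (h a) (h b) (h c)) (hq : IsQuotientMap h) :
    IsOpenMap h := fun _ hU =>
  hq.isOpen_preimage.1 (hμ.isOpen_preimage_image hν hom hU)

/-- The operation on a topological quotient of a topological Mal'tsev algebra is continuous. -/
theorem IsContMaltsevOp.of_isQuotientMap {M : Type u} [TopologicalSpace M]
    {μ : M → M → M → M} (hμ : IsContMaltsevOp μ) {N : Type u} [TopologicalSpace N]
    {ν : N → N → N → N} {h : M → N}
    (hom : ∀ a b c : M, h (μ a b c) = ν (h a) (h b) (h c)) (hq : IsQuotientMap h)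
    (hν₁ : ∀ x y : N, ν x y y = x) (hν₂ : ∀ x y : N, ν y y x = x) :
    IsContMaltsevOp ν := by
  refine ⟨?_, hν₁, hν₂⟩
  have ho : IsOpenQuotientMap h :=
    ⟨hq.surjective, hq.continuous, hμ.isOpenMap_of_isQuotientMap hν₁ hom hq⟩
  rw [(ho.prodMap (ho.prodMap ho)).isQuotientMap.continuous_iff]
  exact (hq.continuous.comp hμ.1).congr fun p => hom p.1 p.2.1 p.2.2

/-- Homomorphisms out of a free topological Mal'tsev algebra are determined on generators. -/
theorem IsFreeTopMaltsev.hom_ext {X : Type u} [TopologicalSpace X] {M : Type u}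
    [TopologicalSpace M] {μ : M → M → M → M} {i : X → M} (hM : IsFreeTopMaltsev X M μ i)
    {N : Type u} {ν : N → N → N → N} {g h : M → N}
    (hg : ∀ a b c : M, g (μ a b c) = ν (g a) (g b) (g c))
    (hh : ∀ a b c : M, h (μ a b c) = ν (h a) (h b) (h c)) (hgh : g ∘ i = h ∘ i) : g = h := by
  have key := hM.2.2.1 {m | g m = h m} (by rintro _ ⟨x, rfl⟩; exact congrFun hgh x)
    (by
      intro a ha b hb c hc
      simp only [Set.mem_ofPred_eq] at ha hb hc ⊢
      rw [hg, hh, ha, hb, hc])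
  exact funext fun m => Set.eq_univ_iff_forall.1 key m

/-- A topology on a free topological Mal'tsev algebra for which the operation and the
inclusion of the generators are continuous is coarser than the free one. -/
theorem IsFreeTopMaltsev.le_topology {X : Type u} [TopologicalSpace X] {M : Type u}
    [t : TopologicalSpace M] {μ : M → M → M → M} {i : X → M} (hM : IsFreeTopMaltsev X M μ i)
    (τ : TopologicalSpace M) (hμ : @IsContMaltsevOp M τ μ) (hi : Continuous[_, τ] i) :
    t ≤ τ := by
  have lift := hM.2.2.2
  obtain ⟨g, hg, hom, hgi⟩ := @lift M τ μ hμ i hi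
  obtain rfl : g = id :=
    @IsFreeTopMaltsev.hom_ext _ _ _ t _ _ hM _ _ _ _ hom (fun _ _ _ => rfl) hgi
  exact continuous_id_iff_le.1 hg

/-- Theorem 1(4): a continuous map `f : X → Y` induces a unique continuous homomorphism
`h : M(X) → M(Y)` with `i_Y ∘ f = h ∘ i_X`; moreover, if the induced map
`i_X(X) → i_Y(Y)` (the restriction of `h`, which sends `i_X x` to `i_Y (f x)`) is a
quotient map, then `h` is open. -/
theorem free_maltsev_functorial
    (X : Type u) [TopologicalSpace X] (Y : Type u) [TopologicalSpace Y]
    (MX : Type u) [TopologicalSpace MX] (μX : MX → MX → MX → MX) (iX : X → MX)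
    (MY : Type u) [TopologicalSpace MY] (μY : MY → MY → MY → MY) (iY : Y → MY)
    (hfreeX : IsFreeTopMaltsev X MX μX iX)
    (hfreeY : IsFreeTopMaltsev Y MY μY iY)
    (f : X → Y) (hf : Continuous f) :
    (∃! h : MX → MY, Continuous h ∧
      (∀ a b c : MX, h (μX a b c) = μY (h a) (h b) (h c)) ∧ iY ∘ f = h ∘ iX) ∧
    (∀ h : MX → MY, Continuous h →
      (∀ a b c : MX, h (μX a b c) = μY (h a) (h b) (h c)) → iY ∘ f = h ∘ iX →
      ∀ (hmaps : Set.MapsTo h (Set.range iX) (Set.range iY)),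
        Topology.IsQuotientMap hmaps.restrict → IsOpenMap h) := by
  refine ⟨?_, fun h hc hom hcomp hmaps hq U hU => ?_⟩
  · obtain ⟨h, hc, hom, hcomp⟩ :=
      hfreeX.2.2.2 MY μY hfreeY.1 (iY ∘ f) (hfreeY.2.1.comp hf)
    exact ⟨h, ⟨hc, hom, hcomp.symm⟩, fun g hg =>
      hfreeX.hom_ext hg.2.1 hom (hg.2.2.symm.trans hcomp.symm)⟩
  · have hsurj : Function.Surjective h := by
      rw [← Set.range_eq_univ]
      refine hfreeY.2.2.1 _ (fun y hy => ?_) ?_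
      · obtain ⟨x, hx⟩ := hq.surjective ⟨y, hy⟩
        exact ⟨x, congrArg Subtype.val hx⟩
      · rintro _ ⟨a, rfl⟩ _ ⟨b, rfl⟩ _ ⟨c, rfl⟩
        exact ⟨μX a b c, hom a b c⟩
    have hquot : @IsQuotientMap MX MY _ (.coinduced h inferInstance) h :=
      @IsQuotientMap.mk _ _ _ (_) _ (@IsCoinducing.mk _ _ _ (_) _ rfl) hsurj
    refine hfreeY.le_topology (.coinduced h inferInstance)
      (@IsContMaltsevOp.of_isQuotientMap _ _ _ hfreeX.1 _ (_) _ _ hom hquot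
        hfreeY.1.2.1 hfreeY.1.2.2) ?_ _
      (isOpen_coinduced.2 (hfreeX.1.isOpen_preimage_image hfreeY.1.2.1 hom hU))
    refine @Continuous.mk _ _ _ (_) _ fun V hV => ?_
    have hV' : IsOpen (Subtype.val ⁻¹' V : Set (Set.range iY)) :=
      hq.isOpen_preimage.1 ((isOpen_coinduced.1 hV).preimage continuous_subtype_val)
    exact hV'.preimage (hfreeY.2.1.subtype_mk fun y => Set.mem_range_self y)
end

section
/- Let X be a topological space and let (M, μ, i) be a free topological Mal'tsev algebra on X. If the space M satisfies the T₀ separation axiom (and hence is Hausdorff), then i(X) is a closed subset of M. -/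
universe u

open Topology in
/-- A T₀ space carrying a continuous Mal'tsev operation is Hausdorff. -/
theorem IsContMaltsevOp.t2Space {M : Type u} [TopologicalSpace M] [T0Space M]
    {μ : M → M → M → M} (hμ : IsContMaltsevOp μ) : T2Space M := by
  obtain ⟨hc, hr, hl⟩ := hμ
  have specializes : ∀ {x y : M}, (𝓝 x ⊓ 𝓝 y).NeBot → y ⤳ x := by
    intro x y hne
    have hlim : Filter.Tendsto (fun z => μ y z z) (𝓝 x ⊓ 𝓝 y) (𝓝 (μ y y x)) :=
      (hc.tendsto (y, y, x)).comp
        (tendsto_const_nhds.prodMk_nhds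
          ((Filter.tendsto_id'.2 inf_le_right).prodMk_nhds (Filter.tendsto_id'.2 inf_le_left)))
    simp only [hr, hl] at hlim
    rw [specializes_iff_forall_open]
    intro U hU hx
    exact Filter.eventually_const.1 (hlim.eventually (hU.mem_nhds hx))
  rw [t2_iff_nhds]
  intro x y hne
  exact ((specializes (inf_comm (𝓝 x) (𝓝 y) ▸ hne)).antisymm (specializes hne)).eq

/-- Formal ternary terms over `X`. -/
inductive TernaryTree (X : Type u) : Type u
  | leaf : X → TernaryTree X
  | node : TernaryTree X → TernaryTree X → TernaryTree X → TernaryTree X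

namespace TernaryTree

variable {X : Type u}

open Classical in
/-- The Mal'tsev operation on terms which forms a node unless a Mal'tsev identity applies. -/
noncomputable def op (a b c : TernaryTree X) : TernaryTree X :=
  if b = c then a else if a = b then c else node a b c

theorem op_right (a b : TernaryTree X) : op a b b = a := by simp [op]

theorem op_left (a b : TernaryTree X) : op b b a = a := by
  by_cases h : b = a <;> simp [op, h]

theorem op_of_ne {a b c : TernaryTree X} (hab : a ≠ b) (hbc : b ≠ c) :
    op a b c = node a b c := by simp [op, hab, hbc]

theorem isContMaltsevOp_op : @IsContMaltsevOp (TernaryTree X) ⊤ op :=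
  letI : TopologicalSpace (TernaryTree X) := ⊤
  ⟨continuous_top, op_right, op_left⟩

/-- Replace every node `(a, b, c)` by `(a, b, (b, a, (a, b, c)))`. -/
def expand : TernaryTree X → TernaryTree X
  | leaf x => leaf x
  | node a b c =>
    node a.expand b.expand (node b.expand a.expand (node a.expand b.expand c.expand))

theorem expand_injective : Function.Injective (expand : TernaryTree X → TernaryTree X) := by
  intro s
  induction s with
  | leaf x => rintro (_ | _) h <;> simp_all [expand]
  | node a b c iha ihb ihc =>
    rintro (_ | ⟨a', b', c'⟩) h
    · simp [expand] at h
    · simp only [expand, node.injEq] at h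
      rw [iha h.1, ihb h.2.1, ihc h.2.2.2.2.2.2]

theorem sizeOf_le_sizeOf_expand (s : TernaryTree X) : sizeOf s ≤ sizeOf s.expand := by
  induction s with
  | leaf x => simp [expand]
  | node a b c iha ihb ihc => simp only [expand, node.sizeOf_spec]; omega

theorem exists_eq_leaf_of_expand_eq {s : TernaryTree X} (h : s.expand = s) :
    ∃ x, s = leaf x := by
  cases s with
  | leaf x => exact ⟨x, rfl⟩
  | node a b c =>
    have hs := congrArg sizeOf h
    have ha := a.sizeOf_le_sizeOf_expand
    have hb := b.sizeOf_le_sizeOf_expand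
    have hc := c.sizeOf_le_sizeOf_expand
    simp only [expand, node.sizeOf_spec] at hs
    omega

theorem expand_op (a b c : TernaryTree X) :
    (op a b c).expand =
      op a.expand b.expand (op b.expand a.expand (op a.expand b.expand c.expand)) := by
  by_cases hbc : b = c
  · subst hbc; simp only [op_right]
  by_cases hab : a = b
  · subst hab; simp only [op_left]
  have hab' := expand_injective.ne hab
  have hbc' := expand_injective.ne hbc
  have ne_node_left : ∀ s t u : TernaryTree X, s ≠ node s t u := by
    intro s t u h
    have := congrArg sizeOf h
    simp only [node.sizeOf_spec] at this
    omega
  rw [op_of_ne hab hbc, op_of_ne hab' hbc', op_of_ne hab'.symm (ne_node_left _ _ _),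
    op_of_ne hab' (ne_node_left _ _ _), expand]

/-- Evaluation of terms in an algebra with a ternary operation. -/
def eval {M : Type u} (μ : M → M → M → M) (i : X → M) : TernaryTree X → M
  | leaf x => i x
  | node a b c => μ (a.eval μ i) (b.eval μ i) (c.eval μ i)

theorem eval_op {M : Type u} {μ : M → M → M → M} (i : X → M) (hr : ∀ x y, μ x y y = x)
    (hl : ∀ x y, μ y y x = x) (a b c : TernaryTree X) :
    (op a b c).eval μ i = μ (a.eval μ i) (b.eval μ i) (c.eval μ i) := by
  by_cases hbc : b = c
  · subst hbc; rw [op_right, hr]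
  by_cases hab : a = b
  · subst hab; rw [op_left, hl]
  rw [op_of_ne hab hbc, eval]

end TernaryTree

theorem IsContMaltsevOp.iterate {M : Type u} [TopologicalSpace M] {μ : M → M → M → M}
    (hμ : IsContMaltsevOp μ) :
    IsContMaltsevOp (fun a b c => μ a b (μ b a (μ a b c))) := by
  obtain ⟨hc, hr, hl⟩ := hμ
  have comp {f g k : M × M × M → M} (hf : Continuous f) (hg : Continuous g)
      (hk : Continuous k) : Continuous (fun p => μ (f p) (g p) (k p)) :=
    hc.comp (hf.prodMk (hg.prodMk hk))
  have h₁ : Continuous (fun p : M × M × M => p.1) := by fun_prop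
  have h₂ : Continuous (fun p : M × M × M => p.2.1) := by fun_prop
  refine ⟨comp h₁ h₂ (comp h₂ h₁ hc), fun x y => ?_, fun x y => ?_⟩ <;> simp only [hr, hl]

/-- Theorem 1(5): if the free topological Mal'tsev algebra `M(X)` is T₀ (hence Hausdorff),
then `i(X)` is closed in `M(X)`. -/
theorem free_maltsev_range_closed_of_t0
    (X : Type u) [TopologicalSpace X] (M : Type u) [TopologicalSpace M]
    (μ : M → M → M → M) (i : X → M)
    (hfree : IsFreeTopMaltsev X M μ i) [T0Space M] :
    IsClosed (Set.range i) := by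
  obtain ⟨hμ, hicont, hgen, huniv⟩ := hfree
  have := hμ.t2Space
  obtain ⟨h, hcont, hhom, hi⟩ := huniv M _ hμ.iterate i hicont
  let _ : TopologicalSpace (TernaryTree X) := ⊤
  obtain ⟨g, -, ghom, gi⟩ :=
    huniv (TernaryTree X) _ TernaryTree.isContMaltsevOp_op TernaryTree.leaf continuous_top
  have eval_g : ∀ m, (g m).eval μ i = m := by
    refine Set.eq_univ_iff_forall.1 (hgen {m | (g m).eval μ i = m} ?_ ?_)
    · rintro _ ⟨x, rfl⟩
      simp only [Set.mem_ofPred_eq, show g (i x) = .leaf x from congrFun gi x, TernaryTree.eval]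
    · intro a ha b hb c hc
      simp only [Set.mem_ofPred_eq] at ha hb hc ⊢
      rw [ghom, TernaryTree.eval_op i hμ.2.1 hμ.2.2, ha, hb, hc]
  have g_h : ∀ m, g (h m) = (g m).expand := by
    refine Set.eq_univ_iff_forall.1 (hgen {m | g (h m) = (g m).expand} ?_ ?_)
    · rintro _ ⟨x, rfl⟩
      simp only [Set.mem_ofPred_eq, show h (i x) = i x from congrFun hi x,
        show g (i x) = .leaf x from congrFun gi x, TernaryTree.expand]
    · intro a ha b hb c hc
      simp only [Set.mem_ofPred_eq] at ha hb hc ⊢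
      simp only [hhom, ghom, ha, hb, hc, TernaryTree.expand_op]
  have range_eq : Set.range i = {m | h m = m} := by
    ext m
    refine ⟨?_, fun hm => ?_⟩
    · rintro ⟨x, rfl⟩
      exact congrFun hi x
    · obtain ⟨x, hx⟩ := TernaryTree.exists_eq_leaf_of_expand_eq
        ((g_h m).symm.trans (congrArg g hm))
      refine ⟨x, ?_⟩
      rw [← eval_g m, hx, TernaryTree.eval]
  rw [range_eq]
  exact isClosed_eq hcont continuous_id
end

section
/- Let X be a topological space and let (M, μ, i) be a free topological Mal'tsev algebra on X. Define M₁(X) = μ(i(X) × i(X) × i(X)) ⊆ M, endowed with the subspace topology (note i(X) ⊆ M₁(X) since μ(a,b,b) = a). Then X admits a continuous Mal'tsev operation (i.e. there is a continuous map m : X × X × X → X with m(x,y,y) = x = m(y,y,x)) if and only if there exists a continuous map r : M₁(X) → X with r ∘ i = id_X. -/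
universe u

/-- Proposition 2: a topological space `X` admits a continuous Mal'tsev operation if and
only if `X` is a retract of the subspace `M₁(X) = μ(i(X) × i(X) × i(X))` of the free
topological Mal'tsev algebra `M(X)` (note `i x ∈ M₁(X)` since `μ a b b = a`). -/
theorem maltsev_space_iff_retract_of_M1
    (X : Type u) [TopologicalSpace X] (M : Type u) [TopologicalSpace M]
    (μ : M → M → M → M) (i : X → M)
    (hfree : IsFreeTopMaltsev X M μ i) :
    (∃ m : X → X → X → X,
      Continuous (fun p : X × X × X => m p.1 p.2.1 p.2.2) ∧
      (∀ x y : X, m x y y = x) ∧ (∀ x y : X, m y y x = x)) ↔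
    (∃ r : {w : M // ∃ a ∈ Set.range i, ∃ b ∈ Set.range i, ∃ c ∈ Set.range i,
        w = μ a b c} → X,
      Continuous r ∧
      ∀ (x : X) (hx : ∃ a ∈ Set.range i, ∃ b ∈ Set.range i, ∃ c ∈ Set.range i,
        i x = μ a b c), r ⟨i x, hx⟩ = x) := by
  obtain ⟨⟨hμ, hl, hr⟩, hi, -, hext⟩ := hfree
  constructor
  · rintro ⟨m, hm⟩
    obtain ⟨h, hc, -, hid⟩ := hext X m hm id continuous_id
    exact ⟨fun w => h w.1, hc.comp continuous_subtype_val, fun x _ => congrFun hid x⟩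
  · rintro ⟨r, hc, hri⟩
    have key : ∀ x y z : X, ∃ a ∈ Set.range i, ∃ b ∈ Set.range i, ∃ c ∈ Set.range i,
        μ (i x) (i y) (i z) = μ a b c :=
      fun x y z => ⟨i x, ⟨x, rfl⟩, i y, ⟨y, rfl⟩, i z, ⟨z, rfl⟩, rfl⟩
    refine ⟨fun x y z => r ⟨μ (i x) (i y) (i z), key x y z⟩, ?_, fun x y => ?_, fun x y => ?_⟩
    · exact hc.comp (Continuous.subtype_mk
        (hμ.comp (f := fun p : X × X × X => (i p.1, i p.2.1, i p.2.2)) (by fun_prop)) _)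
    · simpa only [hl] using hri x (by simpa only [hl] using key x y y)
    · simpa only [hr] using hri x (by simpa only [hr] using key y y x)
end

section
/- Let X be a Tychonoff space and let (M, μ, i) be a free topological Mal'tsev algebra on X. Define subsets Mₙ ⊆ M recursively by M₀ = i(X) and M_{n+1} = μ(Mₙ × Mₙ × Mₙ). Then for every n ∈ ℕ the set Mₙ is closed in M. -/
universe u

open MeasureTheory Set Topology

/-- Lebesgue measure on `[0, 1)`. -/
noncomputable def icoVolume : Measure (Ico (0 : ℝ) 1) := volume.comap Subtype.val

lemma icoVolume_univ : icoVolume univ = 1 := by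
  rw [icoVolume, comap_subtype_coe_apply measurableSet_Ico, image_univ, Subtype.range_coe,
    Real.volume_Ico]
  simp

lemma icoVolume_preimage_le (s : Set ℝ) : icoVolume (Subtype.val ⁻¹' s) ≤ volume s := by
  rw [icoVolume, comap_subtype_coe_apply measurableSet_Ico]
  exact measure_mono (image_preimage_subset _ _)

/-- Functions from `[0, 1)` to `M`, with the extended pseudometric of convergence in measure
for the discrete metric on `M`. -/
def IntervalFun (M : Type u) : Type u := Ico (0 : ℝ) 1 → M

namespace IntervalFun

variable {M : Type u}

noncomputable instance : PseudoEMetricSpace (IntervalFun M) where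
  edist f g := icoVolume {t | f t ≠ g t}
  edist_self f := by simp
  edist_comm f g := by simp only [ne_comm]
  edist_triangle f g k := by
    refine (measure_mono ?_).trans (measure_union_le _ _)
    intro t ht
    by_contra hc
    simp only [mem_union, mem_ofPred_eq, not_or, not_not] at hc
    exact ht (hc.1.trans hc.2)

/-- The constant function with value `a`. -/
def const (a : M) : IntervalFun M := fun _ => a

/-- The pointwise extension of a ternary operation. -/
def map₃ (μ : M → M → M → M) (f g k : IntervalFun M) : IntervalFun M :=
  fun t => μ (f t) (g t) (k t)

lemma edist_def (f g : IntervalFun M) : edist f g = icoVolume {t | f t ≠ g t} := rfl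

lemma edist_const {a b : M} (hab : a ≠ b) : edist (const a) (const b) = 1 := by
  have : {t | const a t ≠ const b t} = univ := by
    ext t
    simpa [const] using hab
  rw [edist_def, this, icoVolume_univ]

lemma edist_map₃_le (μ : M → M → M → M) (f g k f' g' k' : IntervalFun M) :
    edist (map₃ μ f g k) (map₃ μ f' g' k') ≤ edist f f' + (edist g g' + edist k k') := by
  refine (measure_mono ?_).trans
    ((measure_union_le _ _).trans (add_le_add le_rfl (measure_union_le _ _)))
  intro t ht
  by_contra hc
  simp only [mem_union, mem_ofPred_eq, not_or, not_not] at hc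
  exact ht (by simp only [map₃, hc.1, hc.2.1, hc.2.2])

lemma continuous_of_edist_le {Y : Type*} [TopologicalSpace Y] {φ : Y → IntervalFun M}
    {b : Y → Y → ENNReal} (hb : ∀ y, Continuous fun z => b z y) (h0 : ∀ y, b y y = 0)
    (h : ∀ z y, edist (φ z) (φ y) ≤ b z y) : Continuous φ := by
  refine continuous_iff_continuousAt.2 fun y => ?_
  refine tendsto_iff_edist_tendsto_0.2 ?_
  refine tendsto_of_tendsto_of_tendsto_of_le_of_le tendsto_const_nhds ?_
    (fun _ => zero_le) (fun z => h z y)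
  simpa only [h0] using (hb y).tendsto y

lemma isContMaltsevOp_map₃ {μ : M → M → M → M}
    (h₁ : ∀ x y : M, μ x y y = x) (h₂ : ∀ x y : M, μ y y x = x) :
    IsContMaltsevOp (map₃ μ) := by
  refine ⟨?_, fun f g => funext fun t => h₁ _ _, fun f g => funext fun t => h₂ _ _⟩
  refine continuous_of_edist_le
    (b := fun p q => edist p.1 q.1 + (edist p.2.1 q.2.1 + edist p.2.2 q.2.2)) ?_ ?_ ?_
  · intro q
    fun_prop
  · simp
  · exact fun p q => edist_map₃_le μ _ _ _ _ _ _

/-- The function equal to `a` on `[0, s)` and to `f` on `[s, 1)`. -/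
noncomputable def splice (a : M) (s : ℝ) (f : IntervalFun M) : IntervalFun M :=
  fun t => if (t : ℝ) < s then a else f t

lemma edist_splice_le (a : M) (s s' : ℝ) (f f' : IntervalFun M) :
    edist (splice a s f) (splice a s' f') ≤ ENNReal.ofReal |s - s'| + edist f f' := by
  have hsub : {t | splice a s f t ≠ splice a s' f' t} ⊆
      (Subtype.val ⁻¹' Ico (min s s') (max s s')) ∪ {t | f t ≠ f' t} := by
    intro t ht
    by_contra hc
    simp only [mem_union, mem_ofPred_eq, not_or, not_not, mem_preimage, mem_Ico, not_and,
      not_lt, min_le_iff, lt_max_iff] at hc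
    apply ht
    simp only [splice]
    grind
  refine (measure_mono hsub).trans ((measure_union_le _ _).trans (add_le_add ?_ le_rfl))
  refine (icoVolume_preimage_le _).trans ?_
  rw [Real.volume_Ico, max_sub_min_eq_abs']

/-- Prescribed constant values at finitely many points of a normal Hausdorff space extend to a
continuous map into `IntervalFun M`. -/
lemma exists_continuous_eq_const {K : Type*} [TopologicalSpace K] [T4Space K] [Nonempty M]
    (g : K → M) (F : Finset K) :
    ∃ φ : K → IntervalFun M, Continuous φ ∧ ∀ k ∈ F, φ k = const (g k) := by
  classical
  induction F using Finset.induction_on with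
  | empty =>
    exact ⟨fun _ => const (Classical.arbitrary M), continuous_const, by simp⟩
  | insert k F hk ih =>
    obtain ⟨φ, hφ, hF⟩ := ih
    obtain ⟨f, hf0, hf1, -⟩ := exists_continuous_zero_one_of_isClosed
      F.finite_toSet.isClosed (isClosed_singleton (x := k))
      (disjoint_singleton_right.2 (by simpa using hk))
    refine ⟨fun x => splice (g k) (f x) (φ x), ?_, ?_⟩
    · refine continuous_of_edist_le
        (b := fun x y => ENNReal.ofReal |f x - f y| + edist (φ x) (φ y)) ?_ ?_ ?_
      · intro y
        exact (ENNReal.continuous_ofReal.comp (by fun_prop)).add (hφ.edist continuous_const)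
      · simp
      · exact fun x y => edist_splice_le _ _ _ _ _
    · intro x hx
      rcases Finset.mem_insert.1 hx with rfl | hx
      · have : f x = 1 := hf1 rfl
        funext t
        simp only [splice, this, const, if_pos t.2.2]
      · have h0 : f x = 0 := hf0 hx
        rw [← hF x hx]
        funext t
        simp only [splice, h0, if_neg (not_lt.2 t.2.1)]

end IntervalFun

/-- The value of the full ternary term of depth `n` in the operation `ν`, whose leaves are
indexed by the paths `Fin n → Fin 3`. -/
def fullTerm {N : Type*} (ν : N → N → N → N) : (n : ℕ) → ((Fin n → Fin 3) → N) → N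
  | 0, y => y Fin.elim0
  | n + 1, y => ν (fullTerm ν n fun l => y (Fin.cons 0 l)) (fullTerm ν n fun l => y (Fin.cons 1 l))
      (fullTerm ν n fun l => y (Fin.cons 2 l))

lemma map_fullTerm {N P : Type*} {ν : N → N → N → N} {π : P → P → P → P} {h : N → P}
    (hh : ∀ a b c, h (ν a b c) = π (h a) (h b) (h c)) (n : ℕ) (y : (Fin n → Fin 3) → N) :
    h (fullTerm ν n y) = fullTerm π n (h ∘ y) := by
  induction n with
  | zero => rfl
  | succ n ih => simp only [fullTerm, hh, ih, Function.comp_def]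

lemma continuous_fullTerm {N : Type*} [TopologicalSpace N] {ν : N → N → N → N}
    (hν : Continuous fun p : N × N × N => ν p.1 p.2.1 p.2.2) (n : ℕ) :
    Continuous (fullTerm ν n) := by
  induction n with
  | zero => exact continuous_apply _
  | succ n ih =>
    have hc (j : Fin 3) : Continuous fun y : (Fin (n + 1) → Fin 3) → N =>
        fullTerm ν n fun l => y (Fin.cons j l) :=
      ih.comp (continuous_pi fun l => continuous_apply _)
    exact hν.comp ((hc 0).prodMk ((hc 1).prodMk (hc 2)))

lemma eq_range_fullTerm {X M : Type*} {μ : M → M → M → M} {i : X → M} {Mn : ℕ → Set M}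
    (h0 : Mn 0 = range i)
    (hsucc : ∀ n : ℕ,
      Mn (n + 1) = {w : M | ∃ a ∈ Mn n, ∃ b ∈ Mn n, ∃ c ∈ Mn n, w = μ a b c}) (n : ℕ) :
    Mn n = range fun y : (Fin n → Fin 3) → X => fullTerm μ n (i ∘ y) := by
  induction n with
  | zero =>
    rw [h0]
    ext w
    constructor
    · rintro ⟨x, rfl⟩
      exact ⟨fun _ => x, rfl⟩
    · rintro ⟨y, rfl⟩
      exact ⟨y Fin.elim0, rfl⟩
  | succ n ih =>
    rw [hsucc, ih]
    ext w
    constructor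
    · rintro ⟨_, ⟨a, rfl⟩, _, ⟨b, rfl⟩, _, ⟨c, rfl⟩, rfl⟩
      exact ⟨fun l => ![a, b, c] (l 0) (Fin.tail l), by simp [fullTerm, Function.comp_def]⟩
    · rintro ⟨y, rfl⟩
      exact ⟨_, ⟨fun l => y (Fin.cons 0 l), rfl⟩, _, ⟨fun l => y (Fin.cons 1 l), rfl⟩,
        _, ⟨fun l => y (Fin.cons 2 l), rfl⟩, rfl⟩

/-- Two homomorphisms on an algebra generated by `range i` that agree at suitable finitely many
generators agree at a given element. -/
lemma exists_finset_generators {X M N : Type*} {μ : M → M → M → M} {i : X → M}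
    (hgen : ∀ S : Set M, range i ⊆ S → (∀ a ∈ S, ∀ b ∈ S, ∀ c ∈ S, μ a b c ∈ S) → S = univ)
    (ν : N → N → N → N) (w : M) :
    ∃ F : Finset X, ∀ h k : M → N,
      (∀ a b c, h (μ a b c) = ν (h a) (h b) (h c)) →
      (∀ a b c, k (μ a b c) = ν (k a) (k b) (k c)) →
      (∀ x ∈ F, h (i x) = k (i x)) → h w = k w := by
  classical
  suffices hS : {w | ∃ F : Finset X, ∀ h k : M → N,
      (∀ a b c, h (μ a b c) = ν (h a) (h b) (h c)) →
      (∀ a b c, k (μ a b c) = ν (k a) (k b) (k c)) →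
      (∀ x ∈ F, h (i x) = k (i x)) → h w = k w} = univ from
    hS.ge (mem_univ w)
  refine hgen _ ?_ ?_
  · rintro _ ⟨x, rfl⟩
    exact ⟨{x}, fun h k _ _ hx => hx x (by simp)⟩
  · rintro a ⟨Fa, ha⟩ b ⟨Fb, hb⟩ c ⟨Fc, hc⟩
    refine ⟨Fa ∪ Fb ∪ Fc, fun h k hh hk hx => ?_⟩
    rw [hh, hk, ha h k hh hk fun x hxa => hx x (by simp [hxa]),
      hb h k hh hk fun x hxb => hx x (by simp [hxb]),
      hc h k hh hk fun x hxc => hx x (by simp [hxc])]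

/-- An element that is not the value of the full term of depth `n` has a neighbourhood avoiding
the values of that term at all tuples near a given point of a power of the compactification. -/
lemma exists_nhds_fullTerm_notMem {X : Type u} [TopologicalSpace X] [T35Space X]
    {M : Type u} [TopologicalSpace M] {μ : M → M → M → M} {i : X → M}
    (hfree : IsFreeTopMaltsev X M μ i) {n : ℕ} {w : M}
    (hw : w ∉ range fun y : (Fin n → Fin 3) → X => fullTerm μ n (i ∘ y))
    (y : (Fin n → Fin 3) → StoneCech X) :
    ∃ U ∈ 𝓝 y, ∃ V ∈ 𝓝 w, ∀ z : (Fin n → Fin 3) → X,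
      stoneCechUnit ∘ z ∈ U → fullTerm μ n (i ∘ z) ∉ V := by
  classical
  obtain ⟨⟨-, h₁, h₂⟩, -, hgen, hlift⟩ := hfree
  have : Nonempty (StoneCech X) := ⟨y fun _ => 0⟩
  have : Nonempty X := denseRange_stoneCechUnit.nonempty_iff.2 this
  have : Nonempty M := ⟨w⟩
  have hr : Function.LeftInverse (Function.invFun (stoneCechUnit : X → StoneCech X))
      stoneCechUnit := Function.leftInverse_invFun isEmbedding_stoneCechUnit.injective
  set r := Function.invFun (stoneCechUnit : X → StoneCech X)
  have hν := IntervalFun.isContMaltsevOp_map₃ h₁ h₂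
  obtain ⟨F, hF⟩ := exists_finset_generators hgen (IntervalFun.map₃ μ) w
  obtain ⟨φ, hφ, hφF⟩ := IntervalFun.exists_continuous_eq_const (i ∘ r)
    (F.image stoneCechUnit ∪ Finset.univ.image y)
  obtain ⟨h, hh, hhom, hi⟩ := hlift _ _ hν (φ ∘ stoneCechUnit)
    (hφ.comp continuous_stoneCechUnit)
  have hhw : h w = IntervalFun.const w := by
    refine hF h IntervalFun.const hhom (fun _ _ _ => rfl) fun x hx => ?_
    have hx' := hφF (stoneCechUnit x)
      (Finset.mem_union_left _ (Finset.mem_image_of_mem _ hx))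
    rw [← Function.comp_apply (f := h), hi, Function.comp_apply, hx', Function.comp_apply, hr x]
  have hy : fullTerm (IntervalFun.map₃ μ) n (φ ∘ y) =
      IntervalFun.const (fullTerm μ n (i ∘ r ∘ y)) := by
    rw [map_fullTerm (h := IntervalFun.const) (π := IntervalFun.map₃ μ) fun _ _ _ => rfl]
    congr 1
    funext l
    exact hφF (y l) (Finset.mem_union_right _ (Finset.mem_image_of_mem _ (Finset.mem_univ l)))
  have hcont : Continuous fun y' : (Fin n → Fin 3) → StoneCech X =>
      edist (fullTerm (IntervalFun.map₃ μ) n (φ ∘ y')) (IntervalFun.const w) :=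
    ((continuous_fullTerm hν.1 n).comp
      (continuous_pi fun l => hφ.comp (continuous_apply l))).edist continuous_const
  refine ⟨_, (isOpen_lt continuous_const hcont).mem_nhds (?_ : (1 / 2 : ENNReal) < _),
    _, (isOpen_lt (hh.edist continuous_const) continuous_const).mem_nhds
      (?_ : edist (h w) (IntervalFun.const w) < (1 / 2 : ENNReal)), fun z hz hz' => ?_⟩
  · rw [hy, IntervalFun.edist_const fun hc => hw ⟨r ∘ y, hc⟩, one_div]
    exact ENNReal.one_half_lt_one
  · simp [hhw]
  · rw [mem_ofPred_eq, map_fullTerm hhom, ← Function.comp_assoc, hi] at hz'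
    exact lt_asymm hz hz'

/-- For a Tychonoff space `X`, all the sets `Mₙ(X)` (where `M₀ = i(X)` and
`M_{n+1} = μ(Mₙ × Mₙ × Mₙ)`) are closed in the free topological Mal'tsev algebra `M(X)`. -/
theorem free_maltsev_Mn_closed
    (X : Type u) [TopologicalSpace X] [T35Space X]
    (M : Type u) [TopologicalSpace M]
    (μ : M → M → M → M) (i : X → M)
    (hfree : IsFreeTopMaltsev X M μ i)
    (Mn : ℕ → Set M)
    (h0 : Mn 0 = Set.range i)
    (hsucc : ∀ n : ℕ,
      Mn (n + 1) = {w : M | ∃ a ∈ Mn n, ∃ b ∈ Mn n, ∃ c ∈ Mn n, w = μ a b c}) :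
    ∀ n : ℕ, IsClosed (Mn n) := by
  intro n
  rw [eq_range_fullTerm h0 hsucc n, ← isOpen_compl_iff, isOpen_iff_mem_nhds]
  intro w hw
  obtain ⟨V, hV, hVn⟩ : ∃ V ∈ 𝓝 w, ∀ z : (Fin n → Fin 3) → X,
      stoneCechUnit ∘ z ∈ (univ : Set ((Fin n → Fin 3) → StoneCech X)) →
        fullTerm μ n (i ∘ z) ∉ V := by
    refine isCompact_univ.induction_on (p := fun U => ∃ V ∈ 𝓝 w, ∀ z : (Fin n → Fin 3) → X,
      stoneCechUnit ∘ z ∈ U → fullTerm μ n (i ∘ z) ∉ V) ?_ ?_ ?_ ?_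
    · exact ⟨univ, Filter.univ_mem, fun z hz => hz.elim⟩
    · rintro s t hst ⟨V, hV, h⟩
      exact ⟨V, hV, fun z hz => h z (hst hz)⟩
    · rintro s t ⟨V, hV, h⟩ ⟨W, hW, h'⟩
      exact ⟨V ∩ W, Filter.inter_mem hV hW, fun z hz hzm =>
        hz.elim (fun hz => h z hz hzm.1) fun hz => h' z hz hzm.2⟩
    · intro y _
      obtain ⟨U, hU, h⟩ := exists_nhds_fullTerm_notMem hfree hw y
      exact ⟨U, mem_nhdsWithin_of_mem_nhds hU, h⟩
  filter_upwards [hV]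
  rintro _ hv ⟨z, rfl⟩
  exact hVn z (mem_univ _) hv
end
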